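/- Let σ be a real number with 0 < σ < 1 and let w be a real number with w ≥ 1 − σ. Then ζ(σ, w) < 0; in particular ζ(σ, w) ≠ 0. -/

import Mathlib

open Filter Topology

/-- The standard Hurwitz zeta function `ζ(s, w)` for real `w > 0`: the meromorphic continuation
of `∑_{n=0}^∞ (n + w)^{-s}`, expressed via Mathlib's (periodic in `a`) Hurwitz zeta function by
removing the first `⌈w⌉ - 1` terms of the series with parameter `w - (⌈w⌉ - 1) ∈ (0, 1]`. -/
noncomputable def stdHurwitzZeta (s : ℂ) (w : ℝ) : ℂ :=
  HurwitzZeta.hurwitzZeta (w : UnitAddCircle) s -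
    ∑ n ∈ Finset.range (⌈w⌉₊ - 1), (((n : ℝ) + (w - (⌈w⌉₊ - 1 : ℕ))) : ℂ) ^ (-s)

/-- `(x + 1)^{-s} - ∫_x^{x+1} t^{-s} dt`, the integral being written in closed form. -/
noncomputable def powSubIntegral (x : ℝ) (s : ℂ) : ℂ :=
  ((x + 1 : ℝ) : ℂ) ^ (-s) - (((x + 1 : ℝ) : ℂ) ^ (1 - s) - (x : ℂ) ^ (1 - s)) / (1 - s)

lemma hasSum_stdHurwitzZeta {w : ℝ} (hw : 0 < w) {s : ℂ} (hs : 1 < s.re) :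
    HasSum (fun n : ℕ ↦ ((n + w : ℝ) : ℂ) ^ (-s)) (stdHurwitzZeta s w) := by
  set m := ⌈w⌉₊ - 1 with hm
  have hceil : 1 ≤ ⌈w⌉₊ := Nat.one_le_ceil_iff.mpr hw
  have hmc : (m : ℝ) = ⌈w⌉₊ - 1 := by rw [hm]; push_cast [hceil]; ring
  have h1 := Nat.ceil_lt_add_one hw.le
  have h2 := Nat.le_ceil w
  have hmem : w - m ∈ Set.Icc (0 : ℝ) 1 := ⟨by linarith, by linarith⟩
  have hcoe : ((w - m : ℝ) : UnitAddCircle) = (w : UnitAddCircle) := by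
    rw [AddCircle.coe_sub, sub_eq_self]
    have := AddCircle.coe_nsmul (p := (1 : ℝ)) (n := m) (x := 1)
    rw [AddCircle.coe_period] at this
    simpa using this
  have hsum := HurwitzZeta.hasSum_hurwitzZeta_of_one_lt_re hmem hs
  rw [hcoe, ← hasSum_nat_add_iff' m] at hsum
  convert! hsum using 1
  · ext n
    rw [one_div, ← Complex.cpow_neg]
    congr 1
    push_cast
    ring
  · rw [stdHurwitzZeta, ← hm]
    congr 1
    refine Finset.sum_congr rfl fun n _ ↦ ?_
    rw [one_div, ← Complex.cpow_neg]
    push_cast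
    rfl

lemma differentiableAt_stdHurwitzZeta {w : ℝ} (hw : 0 < w) {s : ℂ} (hs : s ≠ 1) :
    DifferentiableAt ℂ (stdHurwitzZeta · w) s := by
  unfold stdHurwitzZeta
  refine (HurwitzZeta.differentiableAt_hurwitzZeta _ hs).sub (DifferentiableAt.fun_sum fun n _ ↦ ?_)
  have hceil : 1 ≤ ⌈w⌉₊ := Nat.one_le_ceil_iff.mpr hw
  have h1 := Nat.ceil_lt_add_one hw.le
  have hpos : (0 : ℝ) < n + (w - (⌈w⌉₊ - 1 : ℕ)) := by
    push_cast [hceil]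
    have : (0 : ℝ) ≤ n := n.cast_nonneg
    linarith
  refine differentiableAt_id.neg.const_cpow (Or.inl ?_)
  exact_mod_cast hpos.ne'

lemma differentiableAt_powSubIntegral {x : ℝ} (hx : 0 < x) {s : ℂ} (hs : s ≠ 1) :
    DifferentiableAt ℂ (powSubIntegral x) s := by
  have hx0 : (x : ℂ) ≠ 0 := by exact_mod_cast hx.ne'
  have hx1 : ((x + 1 : ℝ) : ℂ) ≠ 0 := by exact_mod_cast (by linarith : x + 1 ≠ 0)
  have hs' : 1 - s ≠ 0 := sub_ne_zero.mpr hs.symm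
  have hd : DifferentiableAt ℂ (fun z : ℂ ↦ 1 - z) s := by fun_prop
  exact (differentiableAt_id.neg.const_cpow (Or.inl hx1)).sub
    (((hd.const_cpow (Or.inl hx1)).sub (hd.const_cpow (Or.inl hx0))).div hd hs')

lemma norm_powSubIntegral_le {x : ℝ} (hx : 0 < x) {s : ℂ} (hs : s ≠ 1) (hs0 : 0 < s.re) :
    ‖powSubIntegral x s‖ ≤ ‖s‖ * x ^ (-s.re - 1) := by
  have hs' : 1 - s ≠ 0 := sub_ne_zero.mpr hs.symm
  have hsne : -s ≠ 0 := by
    rintro h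
    simp [neg_eq_zero.mp h] at hs0
  have hbound (t : ℝ) (ht : t ∈ Set.Icc x (x + 1)) :
      ‖((x + 1 : ℝ) : ℂ) ^ (-s) - (t : ℂ) ^ (-s)‖ ≤ ‖s‖ * x ^ (-s.re - 1) := by
    have htx : 0 < t := hx.trans_le ht.1
    have key := norm_image_sub_le_of_norm_deriv_le_segment' (a := t) (b := x + 1)
      (f := fun y : ℝ ↦ (y : ℂ) ^ (-s)) (C := ‖s‖ * x ^ (-s.re - 1))
      (fun y hy ↦ (hasDerivAt_ofReal_cpow_const (htx.trans_le hy.1).ne' hsne).hasDerivWithinAt)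
      (fun y hy ↦ by
        rw [norm_mul, norm_neg, Complex.norm_cpow_eq_rpow_re_of_pos (htx.trans_le hy.1)]
        gcongr
        simp only [Complex.sub_re, Complex.neg_re, Complex.one_re]
        exact Real.rpow_le_rpow_of_nonpos hx (ht.1.trans hy.1) (by linarith))
      (x + 1) ⟨ht.2, le_rfl⟩
    refine key.trans (mul_le_of_le_one_right (by positivity) ?_)
    linarith [ht.1]
  have hderiv (t : ℝ) (ht : t ∈ Set.Icc x (x + 1)) :
      HasDerivWithinAt (fun y : ℝ ↦ (y : ℂ) * ((x + 1 : ℝ) : ℂ) ^ (-s) - (y : ℂ) ^ (1 - s) / (1 - s))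
        (((x + 1 : ℝ) : ℂ) ^ (-s) - (t : ℂ) ^ (-s)) (Set.Icc x (x + 1)) t := by
    have h1 := hasDerivAt_ofReal_cpow_const' (x := t) (hx.trans_le ht.1).ne' (r := -s)
      (fun h ↦ hs (neg_injective h))
    rw [neg_add_eq_sub] at h1
    have h2 := (Complex.ofRealCLM.hasDerivAt (x := t)).mul_const (((x + 1 : ℝ) : ℂ) ^ (-s))
    simpa using! (h2.sub h1).hasDerivWithinAt
  have key := norm_image_sub_le_of_norm_deriv_le_segment' hderiv
    (fun t ht ↦ hbound t (Set.Ico_subset_Icc_self ht)) (x + 1) ⟨by linarith, le_rfl⟩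
  simp only [add_sub_cancel_left, mul_one] at key
  convert! key using 2
  rw [powSubIntegral]
  push_cast
  ring

lemma summable_nat_add_rpow {w : ℝ} (hw : 0 < w) {p : ℝ} (hp : 0 < p) :
    Summable fun n : ℕ ↦ (n + w) ^ (-p - 1) := by
  refine ((Real.summable_one_div_nat_add_rpow w (p + 1)).mpr (by linarith)).congr fun n ↦ ?_
  rw [abs_of_pos (by positivity), one_div, ← Real.rpow_neg (by positivity)]
  ring_nf

lemma summable_powSubIntegral {w : ℝ} (hw : 0 < w) {s : ℂ} (hs : s ≠ 1) (hs0 : 0 < s.re) :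
    Summable fun n : ℕ ↦ powSubIntegral (n + w) s :=
  ((summable_nat_add_rpow hw hs0).mul_left ‖s‖).of_norm_bounded
    fun _ ↦ norm_powSubIntegral_le (by positivity) hs hs0

lemma differentiableAt_tsum_powSubIntegral {w : ℝ} (hw : 0 < w) {s : ℂ} (hs : s ≠ 1)
    (hs0 : 0 < s.re) :
    DifferentiableAt ℂ (fun z ↦ ∑' n : ℕ, powSubIntegral (n + w) z) s := by
  set ε := s.re / 2 with hε
  set R := ‖s‖ + 1 with hR
  have hε0 : 0 < ε := by positivity
  have hR0 : 0 < R := by positivity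
  set U : Set ℂ := {z | ε < z.re} ∩ {z | ‖z‖ < R} ∩ {1}ᶜ with hU
  have hUo : IsOpen U := ((isOpen_lt continuous_const Complex.continuous_re).inter
    (isOpen_lt continuous_norm continuous_const)).inter isOpen_compl_singleton
  have hsU : s ∈ U := ⟨⟨by simp only [Set.mem_ofPred_eq]; linarith,
    by simp only [Set.mem_ofPred_eq]; linarith⟩, hs⟩
  refine (Complex.differentiableOn_tsum_of_summable_norm
    (u := fun n : ℕ ↦ R * ((n + w) ^ (-ε - 1) + (n + w) ^ (-R - 1)))
    (((summable_nat_add_rpow hw hε0).add (summable_nat_add_rpow hw hR0)).mul_left R)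
    (fun n z hz ↦ (differentiableAt_powSubIntegral (by positivity) hz.2).differentiableWithinAt)
    hUo fun n z hz ↦ ?_).differentiableAt (hUo.mem_nhds hsU)
  obtain ⟨⟨hz1 : ε < z.re, hz2 : ‖z‖ < R⟩, hz3⟩ := hz
  have hx : 0 < n + w := by positivity
  refine (norm_powSubIntegral_le hx hz3 (hε0.trans hz1)).trans ?_
  have hre : z.re ≤ R := (Complex.re_le_norm z).trans hz2.le
  gcongr
  rcases le_total 1 (n + w) with h | h
  · have h1 : (n + w) ^ (-z.re - 1) ≤ (n + w) ^ (-ε - 1) :=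
      Real.rpow_le_rpow_of_exponent_le h (by linarith)
    have h2 : 0 ≤ (n + w) ^ (-R - 1) := by positivity
    linarith
  · have h1 : (n + w) ^ (-z.re - 1) ≤ (n + w) ^ (-R - 1) :=
      Real.rpow_le_rpow_of_exponent_ge hx h (by linarith)
    have h2 : 0 ≤ (n + w) ^ (-ε - 1) := by positivity
    linarith

lemma stdHurwitzZeta_eq_of_one_lt_re {w : ℝ} (hw : 0 < w) {s : ℂ} (hs : 1 < s.re) :
    stdHurwitzZeta s w = (w : ℂ) ^ (-s) + (w : ℂ) ^ (1 - s) / (s - 1) +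
      ∑' n : ℕ, powSubIntegral (n + w) s := by
  have hs1 : s ≠ 1 := by
    rintro rfl
    simp at hs
  have hsum := ((hasSum_nat_add_iff' 1).mpr (hasSum_stdHurwitzZeta hw hs)).tendsto_sum_nat
  have hlim : Tendsto (fun n : ℕ ↦ ((n + w : ℝ) : ℂ) ^ (1 - s)) atTop (𝓝 0) := by
    rw [tendsto_zero_iff_norm_tendsto_zero]
    have := (tendsto_rpow_neg_atTop (sub_pos.mpr hs)).comp
      (tendsto_atTop_add_const_right _ w tendsto_natCast_atTop_atTop)
    refine this.congr fun n ↦ ?_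
    rw [Complex.norm_cpow_eq_rpow_re_of_pos (by positivity)]
    simp
  have htend := hsum.sub ((hlim.sub_const ((w : ℂ) ^ (1 - s))).div_const (1 - s))
  have huniq := tendsto_nhds_unique (htend.congr fun N ↦ ?_)
    (summable_powSubIntegral hw hs1 (by linarith)).hasSum.tendsto_sum_nat
  · rw [← huniq]
    have : s - 1 ≠ 0 := sub_ne_zero.mpr hs1
    have : 1 - s ≠ 0 := sub_ne_zero.mpr hs1.symm
    simp only [Finset.range_one, Finset.sum_singleton, Nat.cast_zero, zero_add, zero_sub]
    field_simp
    ring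
  · have htele := Finset.sum_range_sub (fun n : ℕ ↦ ((n + w : ℝ) : ℂ) ^ (1 - s)) N
    simp only [Nat.cast_zero, zero_add] at htele
    rw [← htele, Finset.sum_div, ← Finset.sum_sub_distrib]
    refine Finset.sum_congr rfl fun n _ ↦ ?_
    rw [powSubIntegral]
    push_cast
    ring_nf

/-- The Euler–Maclaurin type continuation of the Hurwitz zeta function to `0 < re s < 1`. -/
lemma stdHurwitzZeta_eq {w : ℝ} (hw : 0 < w) {s : ℂ} (hs0 : 0 < s.re) (hs1 : s.re < 1) :
    stdHurwitzZeta s w = (w : ℂ) ^ (-s) + (w : ℂ) ^ (1 - s) / (s - 1) +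
      ∑' n : ℕ, powSubIntegral (n + w) s := by
  have hw0 : (w : ℂ) ≠ 0 := by exact_mod_cast hw.ne'
  set A : Set ℂ := {z | 1 < z.re} with hA
  set B : Set ℂ := {z | 0 < z.re} ∩ {z | 0 < z.im} with hB
  set C : Set ℂ := {z | 0 < z.re} ∩ {z | z.re < 1} with hC
  have hopen : IsOpen (A ∪ B ∪ C) :=
    ((isOpen_lt continuous_const Complex.continuous_re).union
      ((isOpen_lt continuous_const Complex.continuous_re).inter
        (isOpen_lt continuous_const Complex.continuous_im))).union
      ((isOpen_lt continuous_const Complex.continuous_re).inter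
        (isOpen_lt Complex.continuous_re continuous_const))
  have hconn : IsPreconnected (A ∪ B ∪ C) := by
    have hAc : IsPreconnected A := (convex_halfSpace_re_gt 1).isPreconnected
    have hBc : IsPreconnected B :=
      ((convex_halfSpace_re_gt 0).inter (convex_halfSpace_im_gt 0)).isPreconnected
    have hCc : IsPreconnected C :=
      ((convex_halfSpace_re_gt 0).inter (convex_halfSpace_re_lt 1)).isPreconnected
    refine (hAc.union ⟨2, 1⟩ ?_ ?_ hBc).union ⟨1 / 2, 1⟩ (Or.inr ?_) ?_ hCc <;>
      norm_num [hA, hB, hC]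
  have hU (z : ℂ) (hz : z ∈ A ∪ B ∪ C) : 0 < z.re ∧ z ≠ 1 := by
    refine ⟨?_, ?_⟩
    · rcases hz with (hz | hz) | hz
      · exact zero_lt_one.trans hz
      · exact hz.1
      · exact hz.1
    · rintro rfl
      simp [hA, hB, hC] at hz
  have hf : AnalyticOnNhd ℂ (stdHurwitzZeta · w) (A ∪ B ∪ C) :=
    DifferentiableOn.analyticOnNhd
      (fun z hz ↦ (differentiableAt_stdHurwitzZeta hw (hU z hz).2).differentiableWithinAt) hopen
  have hg : AnalyticOnNhd ℂ (fun z ↦ (w : ℂ) ^ (-z) + (w : ℂ) ^ (1 - z) / (z - 1) +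
      ∑' n : ℕ, powSubIntegral (n + w) z) (A ∪ B ∪ C) := by
    refine DifferentiableOn.analyticOnNhd (fun z hz ↦ ?_) hopen
    obtain ⟨hz0, hz1⟩ := hU z hz
    have hd : DifferentiableAt ℂ (fun z : ℂ ↦ 1 - z) z := by fun_prop
    have hp : DifferentiableAt ℂ (fun z : ℂ ↦ (w : ℂ) ^ (-z)) z :=
      DifferentiableAt.const_cpow (by fun_prop) (Or.inl hw0)
    have hq : DifferentiableAt ℂ (fun z : ℂ ↦ (w : ℂ) ^ (1 - z) / (z - 1)) z :=
      (hd.const_cpow (Or.inl hw0)).fun_div (by fun_prop) (sub_ne_zero.mpr hz1)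
    exact ((hp.fun_add hq).fun_add
      (differentiableAt_tsum_powSubIntegral hw hz1 hz0)).differentiableWithinAt
  have hA2 : (2 : ℂ) ∈ A := by simp [hA]
  refine hf.eqOn_of_preconnected_of_eventuallyEq hg hconn (Or.inl (Or.inl hA2)) ?_
    (Or.inr ⟨hs0, hs1⟩)
  filter_upwards [(isOpen_lt continuous_const Complex.continuous_re).mem_nhds hA2] with z hz
  exact stdHurwitzZeta_eq_of_one_lt_re hw hz

lemma powSubIntegral_ofReal {x : ℝ} (hx : 0 < x) (σ : ℝ) :
    powSubIntegral x σ =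
      (((x + 1) ^ (-σ) - ((x + 1) ^ (1 - σ) - x ^ (1 - σ)) / (1 - σ) : ℝ) : ℂ) := by
  rw [powSubIntegral]
  push_cast [Complex.ofReal_cpow hx.le, Complex.ofReal_cpow (by linarith : 0 ≤ x + 1)]
  rfl

lemma rpow_neg_sub_integral_neg {x σ : ℝ} (hx : 0 < x) (hσ0 : 0 < σ) (hσ1 : σ < 1) :
    (x + 1) ^ (-σ) - ((x + 1) ^ (1 - σ) - x ^ (1 - σ)) / (1 - σ) < 0 := by
  have hy : 0 < x + 1 := by linarith
  have hσ : 0 < 1 - σ := by linarith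
  have hbern := rpow_one_add_lt_one_add_mul_self (s := -(x + 1)⁻¹) (p := 1 - σ)
    (neg_le_neg (inv_le_one_of_one_le₀ (by linarith))) (by simp [hy.ne']) hσ (by linarith)
  have hdiv : 1 + -(x + 1)⁻¹ = x / (x + 1) := by field_simp; ring
  rw [hdiv, Real.div_rpow hx.le hy.le, div_lt_iff₀ (by positivity)] at hbern
  have hpow : (x + 1) ^ (1 - σ) = (x + 1) ^ (-σ) * (x + 1) := by
    rw [← Real.rpow_add_one hy.ne']
    ring_nf
  rw [sub_neg, lt_div_iff₀ hσ]
  have hexp : (1 + (1 - σ) * -(x + 1)⁻¹) * (x + 1) ^ (1 - σ) =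
      (x + 1) ^ (1 - σ) - (x + 1) ^ (-σ) * (1 - σ) := by
    rw [hpow]
    field_simp
    ring
  linarith

open ComplexOrder in
/-- For `0 < σ < 1` and `w ≥ 1 - σ`, the Hurwitz zeta function `ζ(σ, w)` is negative,
and in particular nonzero. -/
theorem hurwitzZeta_neg_of_le (σ w : ℝ) (hσ0 : 0 < σ) (hσ1 : σ < 1) (hw : 1 - σ ≤ w) :
    stdHurwitzZeta (σ : ℂ) w < 0 ∧ stdHurwitzZeta (σ : ℂ) w ≠ 0 := by
  suffices h : stdHurwitzZeta (σ : ℂ) w < 0 from ⟨h, h.ne⟩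
  have hw0 : 0 < w := by linarith
  have hsumm := summable_powSubIntegral hw0 (s := (σ : ℂ)) (by exact_mod_cast hσ1.ne) (by simpa)
  have hterm (n : ℕ) := powSubIntegral_ofReal (x := n + w) (by positivity) σ
  have hneg (n : ℕ) := rpow_neg_sub_integral_neg (x := n + w) (by positivity) hσ0 hσ1
  rw [stdHurwitzZeta_eq hw0 (by simpa) (by simpa)]
  simp only [hterm] at hsumm ⊢
  rw [Complex.summable_ofReal] at hsumm
  have htsum := hsumm.tsum_lt_tsum (fun n ↦ (hneg n).le) (hneg 0) summable_zero
  rw [tsum_zero] at htsum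
  have hmain : w ^ (-σ) + w ^ (1 - σ) / (σ - 1) ≤ 0 := by
    have hpow : w ^ (1 - σ) = w ^ (-σ) * w := by
      rw [← Real.rpow_add_one hw0.ne']
      ring_nf
    have hσ : σ - 1 < 0 := by linarith
    have hfac : w ^ (-σ) + w ^ (1 - σ) / (σ - 1) = w ^ (-σ) * ((σ - 1 + w) / (σ - 1)) := by
      rw [hpow]
      field_simp [hσ.ne]
    rw [hfac]
    exact mul_nonpos_of_nonneg_of_nonpos (by positivity)
      (div_nonpos_of_nonneg_of_nonpos (by linarith) hσ.le)
  have hreal := add_neg_of_nonpos_of_neg hmain htsum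
  rw [← Complex.ofReal_tsum]
  have hcast := Complex.real_lt_real.mpr hreal
  push_cast [Complex.ofReal_cpow hw0.le] at hcast
  push_cast
  exact hcast
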